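/- There exists a constant c ≥ 1 such that for every n ≥ 1, |F(n)| ≤ (1 + c·η^{−n})·|T(n)|, where η = 2^{1/3000}, F(n) is the set of I₃-free digraphs on {0,…,n−1} and T(n) is the set of bitournaments on {0,…,n−1}. -/

import Mathlib

open scoped Classical

/-- `E` is a digraph relation on `Fin n`: irreflexive and asymmetric. -/
def DigraphOn (n : ℕ) (E : Fin n → Fin n → Bool) : Prop :=
  (∀ x, E x x = false) ∧ ∀ x y, E x y = true → E y x = false

/-- `E` is I₃-free: any three distinct vertices span at least one arrow. -/
def I3FreeOn (n : ℕ) (E : Fin n → Fin n → Bool) : Prop :=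
  ∀ x y z : Fin n, x ≠ y → y ≠ z → x ≠ z →
    E x y = true ∨ E y x = true ∨ E y z = true ∨ E z y = true ∨
    E x z = true ∨ E z x = true

/-- The set `S` induces a tournament in `E`. -/
def IndTournOn (n : ℕ) (E : Fin n → Fin n → Bool) (S : Finset (Fin n)) : Prop :=
  ∀ x ∈ S, ∀ y ∈ S, x ≠ y → E x y = true ∨ E y x = true

/-- `E` is a bitournament: a digraph whose vertex set splits into two tournaments. -/
def BitournOn (n : ℕ) (E : Fin n → Fin n → Bool) : Prop :=
  DigraphOn n E ∧ ∃ S : Finset (Fin n), IndTournOn n E S ∧ IndTournOn n E Sᶜ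

/-- The set of I₃-free digraphs on `{0, …, n-1}`. -/
noncomputable def Fset (n : ℕ) : Finset (Fin n → Fin n → Bool) :=
  Finset.univ.filter fun E => DigraphOn n E ∧ I3FreeOn n E

/-- The set of bitournaments on `{0, …, n-1}`. -/
noncomputable def Tset (n : ℕ) : Finset (Fin n → Fin n → Bool) :=
  Finset.univ.filter fun E => BitournOn n E

/-- `x ≁ y` : distinct, unrelated vertices. -/
def NadjOn (n : ℕ) (E : Fin n → Fin n → Bool) (x y : Fin n) : Prop :=
  x ≠ y ∧ E x y = false ∧ E y x = false

/-- `Δ(v)`, the set of vertices non-adjacent to `v`. -/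
noncomputable def DeltaOn (n : ℕ) (E : Fin n → Fin n → Bool) (v : Fin n) : Finset (Fin n) :=
  Finset.univ.filter fun x => NadjOn n E x v

/-- `Δ(Q) = (⋃_{v ∈ Q} Δ(v)) \ Q`. -/
noncomputable def DeltaSetOn (n : ℕ) (E : Fin n → Fin n → Bool) (Q : Finset (Fin n)) :
    Finset (Fin n) :=
  (Q.biUnion (DeltaOn n E)) \ Q


lemma core_count {n m k : ℕ} (φ : Fin m → Fin n) (ψ : Fin k → Fin n)
    (hφ : Function.Injective φ)
    (hcov : ∀ v, (∃ j, φ j = v) ∨ ∃ i, ψ i = v)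
    (X : Finset (Fin n → Fin n → Bool)) (hX : X ⊆ Fset n)
    (Opt : (Fin m → Fin m → Bool) → Fin m → Finset (Fin k → Bool × Bool))
    (M : ℝ) (hM0 : 0 ≤ M)
    (hOpt : ∀ E ∈ X, ∀ j, (fun i => (E (ψ i) (φ j), E (φ j) (ψ i))) ∈
      Opt (fun a b => E (φ a) (φ b)) j)
    (hM : ∀ E ∈ X, ((∏ j, (Opt (fun a b => E (φ a) (φ b)) j).card : ℕ) : ℝ) ≤ M) :
    (X.card : ℝ) ≤ (2 : ℝ) ^ (k * k) * M * ((Fset m).card : ℝ) := by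
  have hmap : Set.MapsTo (fun (E : Fin n → Fin n → Bool) (a b : Fin m) => E (φ a) (φ b))
      (X : Set (Fin n → Fin n → Bool)) (Fset m : Set (Fin m → Fin m → Bool)) := by
    intro E hE
    rw [Finset.mem_coe] at hE ⊢
    have h := hX hE
    simp only [Fset, Finset.mem_filter, Finset.mem_univ, true_and] at h ⊢
    obtain ⟨⟨h1, h2⟩, h3⟩ := h
    refine ⟨⟨fun x => h1 _, fun x y => h2 _ _⟩, ?_⟩
    intro x y z hxy hyz hxz
    exact h3 _ _ _ (hφ.ne hxy) (hφ.ne hyz) (hφ.ne hxz)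
  rw [Finset.card_eq_sum_card_fiberwise hmap]
  push_cast
  refine (Finset.sum_le_card_nsmul _ _ ((2 : ℝ) ^ (k * k) * M) ?_).trans
    (le_of_eq (by rw [nsmul_eq_mul]; ring))
  intro E' _
  by_cases hne : ∃ E ∈ X, (fun a b => E (φ a) (φ b)) = E'
  · obtain ⟨E0, hE0, hE0'⟩ := hne
    have hM' := hM E0 hE0
    rw [hE0'] at hM'
    have hcard : (X.filter (fun E => (fun a b => E (φ a) (φ b)) = E')).card ≤
        ((Finset.univ : Finset (Fin k → Fin k → Bool)) ×ˢ
          (Fintype.piFinset (Opt E'))).card := by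
      apply Finset.card_le_card_of_injOn
        (fun E => ((fun a b => E (ψ a) (ψ b)),
          (fun j i => (E (ψ i) (φ j), E (φ j) (ψ i)))))
      · intro E hE
        have hE := Finset.mem_filter.1 hE
        simp only [Finset.coe_product, Set.mem_prod, Finset.mem_coe, Finset.mem_univ, true_and,
          Fintype.mem_piFinset]
        intro j
        have := hOpt E hE.1 j
        rw [hE.2] at this
        exact this
      · intro E1 h1 E2 h2 h
        have h1 := (Finset.mem_filter.1 h1).2
        have h2 := (Finset.mem_filter.1 h2).2
        have h12 := h1.trans h2.symm
        simp only [Prod.mk.injEq] at h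
        obtain ⟨ha, hb⟩ := h
        have e1 : ∀ a b, E1 (φ a) (φ b) = E2 (φ a) (φ b) := fun a b => congrFun (congrFun h12 a) b
        have e2 : ∀ a b, E1 (ψ a) (ψ b) = E2 (ψ a) (ψ b) := fun a b => congrFun (congrFun ha a) b
        have e3 : ∀ j i, E1 (ψ i) (φ j) = E2 (ψ i) (φ j) ∧ E1 (φ j) (ψ i) = E2 (φ j) (ψ i) := by
          intro j i
          have := congrFun (congrFun hb j) i
          simpa using this
        funext u v
        rcases hcov u with ⟨a, rfl⟩ | ⟨a, rfl⟩ <;> rcases hcov v with ⟨b, rfl⟩ | ⟨b, rfl⟩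
        · exact e1 a b
        · exact (e3 a b).2
        · exact (e3 b a).1
        · exact e2 a b
    have h2 : ((Finset.univ : Finset (Fin k → Fin k → Bool)) ×ˢ
          (Fintype.piFinset (Opt E'))).card = 2 ^ (k * k) * ∏ j, (Opt E' j).card := by
      rw [Finset.card_product, Fintype.card_piFinset]
      simp [pow_mul]
    rw [h2] at hcard
    calc ((X.filter (fun E => (fun a b => E (φ a) (φ b)) = E')).card : ℝ)
        ≤ ((2 ^ (k * k) * ∏ j, (Opt E' j).card : ℕ) : ℝ) := by exact_mod_cast hcard
      _ = (2 : ℝ) ^ (k * k) * ((∏ j, (Opt E' j).card : ℕ) : ℝ) := by push_cast; ring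
      _ ≤ _ := by gcongr
  · have : X.filter (fun E => (fun a b => E (φ a) (φ b)) = E') = ∅ := by
      apply Finset.filter_eq_empty_iff.2
      intro E hE h
      exact hne ⟨E, hE, h⟩
    rw [this]
    simp
    positivity

/-- complement parametrisation -/
lemma exists_compl {n k : ℕ} (ψ : Fin k → Fin n) (hψ : Function.Injective ψ) :
    ∃ φ : Fin (n - k) → Fin n, Function.Injective φ ∧
      (∀ v, (∃ j, φ j = v) ∨ ∃ i, ψ i = v) ∧ ∀ j i, φ j ≠ ψ i := by
  have hc : ((Finset.univ.image ψ)ᶜ).card = n - k := by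
    rw [Finset.card_compl, Finset.card_image_of_injective _ hψ]; simp
  let e := Finset.orderIsoOfFin _ hc
  refine ⟨fun j => (e j).1, fun a b h => e.injective (Subtype.ext h), ?_, ?_⟩
  · intro v
    by_cases hv : v ∈ (Finset.univ.image ψ)ᶜ
    · left
      exact ⟨e.symm ⟨v, hv⟩, by simp⟩
    · right
      simpa using hv
  · intro j i h
    have := (e j).2
    simp only [Finset.mem_compl, Finset.mem_image, Finset.mem_univ, true_and, not_exists] at this
    exact this i h.symm

/-- nonadjacency neighbourhood of a set -/
noncomputable def NS (n : ℕ) (E : Fin n → Fin n → Bool) (P : Finset (Fin n)) : Finset (Fin n) :=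
  P.biUnion (DeltaOn n E)

lemma NadjOn.symm {n : ℕ} {E : Fin n → Fin n → Bool} {x y : Fin n} (h : NadjOn n E x y) :
    NadjOn n E y x := ⟨h.1.symm, h.2.2, h.2.1⟩

lemma mem_Delta {n : ℕ} {E : Fin n → Fin n → Bool} {x y : Fin n} :
    x ∈ DeltaOn n E y ↔ NadjOn n E x y := by simp [DeltaOn]

lemma mem_NS {n : ℕ} {E : Fin n → Fin n → Bool} {P : Finset (Fin n)} {x : Fin n} :
    x ∈ NS n E P ↔ ∃ q ∈ P, NadjOn n E x q := by simp [NS, DeltaOn]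

lemma NS_mono {n : ℕ} {E : Fin n → Fin n → Bool} {P P' : Finset (Fin n)} (h : P ⊆ P') :
    NS n E P ⊆ NS n E P' := Finset.biUnion_subset_biUnion_of_subset_left _ h

lemma exists_image {n k : ℕ} (P : Finset (Fin n)) (hP : P.Nonempty) (hk : P.card ≤ k) :
    ∃ p : Fin k → Fin n, Finset.univ.image p = P := by
  have : Nonempty (P ↪ Fin k) := by
    apply Function.Embedding.nonempty_of_card_le
    simpa using hk
  obtain ⟨g⟩ := this
  obtain ⟨a, ha⟩ := hP
  have : Nonempty P := ⟨⟨a, ha⟩⟩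
  refine ⟨fun i => (Function.invFun g i).1, ?_⟩
  ext v
  simp only [Finset.mem_image, Finset.mem_univ, true_and]
  constructor
  · rintro ⟨i, rfl⟩; exact (Function.invFun g i).2
  · intro hv
    obtain ⟨i, hi⟩ := Function.invFun_surjective g.injective ⟨v, hv⟩
    exact ⟨i, by rw [hi]⟩

/-- The structural lemma. -/
lemma structural {n k : ℕ} (E : Fin n → Fin n → Bool) (hn : 1 ≤ n) (hk : 1 ≤ k)
    (hA : ∀ v, k + 2 ≤ (DeltaOn n E v).card)
    (hB : ∀ P : Finset (Fin n), P.card = k → 499 * n < 1000 * (NS n E P).card)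
    (hC : ∀ x y, NadjOn n E x y → ∀ P P' : Finset (Fin n), P ⊆ DeltaOn n E x →
      P' ⊆ DeltaOn n E y → y ∉ P → x ∉ P' → k ≤ P.card → k ≤ P'.card → P.card ≤ k + 1 →
      P'.card ≤ k + 1 → 100 * (NS n E P ∩ NS n E P').card < n) :
    ∃ S : Finset (Fin n), IndTournOn n E S ∧ IndTournOn n E Sᶜ := by
  have hQ : ∀ v, ∃ Q ⊆ DeltaOn n E v, Q.card = k + 1 := fun v =>
    Finset.exists_subset_card_eq (by have := hA v; omega)
  choose Q hQs hQc using hQ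
  set R : Fin n → Finset (Fin n) := fun v => NS n E (Q v) with hR
  -- a k-subset of Q x avoiding y
  have hP : ∀ x y, ∃ P ⊆ Q x, y ∉ P ∧ P.card = k := by
    intro x y
    obtain ⟨P, hP, hPc⟩ := Finset.exists_subset_card_eq (s := (Q x).erase y) (n := k) (by
      have := Finset.pred_card_le_card_erase (s := Q x) (a := y)
      have := hQc x; omega)
    exact ⟨P, hP.trans (Finset.erase_subset _ _), fun h => by simpa using hP h, hPc⟩
  have hn' : ∀ A : Finset (Fin n), A.card ≤ n := fun A => by
    simpa using Finset.card_le_univ A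
  have h1 : ∀ x, 499 * n < 1000 * (R x).card := by
    intro x
    obtain ⟨P, hPs, _, hPc⟩ := hP x x
    have := hB P hPc
    have := Finset.card_le_card (NS_mono (E := E) hPs)
    simp only [hR]; omega
  have h2 : ∀ x, 1000 * (R x).card < 511 * n := by
    intro x
    obtain ⟨z, hz, hzQ⟩ := Finset.exists_mem_notMem_of_card_lt_card
      (s := Q x) (t := DeltaOn n E x) (by have := hA x; have := hQc x; omega)
    obtain ⟨P, hPs, hxP, hPc⟩ := hP z x
    have hzx := mem_Delta.1 hz
    have a1 := hC x z hzx.symm (Q x) P (hQs x) (hPs.trans (hQs z)) hzQ hxP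
      (by have := hQc x; omega) (by omega) (by have := hQc x; omega) (by omega)
    have a2 := hB P hPc
    have a3 := Finset.card_union_add_card_inter (R x) (NS n E P)
    have a4 := hn' (R x ∪ NS n E P)
    simp only [hR] at *; omega
  have h3 : ∀ x y, NadjOn n E x y → 1000 * (R x ∩ R y).card < 34 * n := by
    intro x y hxy
    obtain ⟨P, hPs, hyP, hPc⟩ := hP x y
    obtain ⟨P', hPs', hxP', hPc'⟩ := hP y x
    have a1 := hC x y hxy P P' (hPs.trans (hQs x)) (hPs'.trans (hQs y)) hyP hxP'
      (by omega) (by omega) (by omega) (by omega)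
    have a2 := hB P hPc
    have a3 := hB P' hPc'
    have b1 := Finset.card_sdiff_add_card_eq_card (NS_mono (E := E) hPs)
    have b2 := Finset.card_sdiff_add_card_eq_card (NS_mono (E := E) hPs')
    have c1 := h2 x
    have c2 := h2 y
    have hsub : R x ∩ R y ⊆ (NS n E P ∩ NS n E P') ∪ ((R x \ NS n E P) ∪ (R y \ NS n E P')) := by
      intro w hw
      simp only [Finset.mem_inter, Finset.mem_union, Finset.mem_sdiff] at *
      tauto
    have d1 := Finset.card_le_card hsub
    have d2 := Finset.card_union_le (NS n E P ∩ NS n E P') ((R x \ NS n E P) ∪ (R y \ NS n E P'))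
    have d3 := Finset.card_union_le (R x \ NS n E P) (R y \ NS n E P')
    simp only [hR] at *; omega
  have h4 : ∀ x y z, NadjOn n E x y → NadjOn n E z y → 1000 * (R x \ R z).card < 70 * n := by
    intro x y z hxy hzy
    have a1 := h3 x y hxy
    have a2 := h3 z y hzy
    have a3 := Finset.card_union_add_card_inter (R z) (R y)
    have a4 := h1 z
    have a5 := h1 y
    have hsub : R x \ R z ⊆ (R x ∩ R y) ∪ (R z ∪ R y)ᶜ := by
      intro w hw
      simp only [Finset.mem_inter, Finset.mem_union, Finset.mem_sdiff, Finset.mem_compl] at *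
      tauto
    have d1 := Finset.card_le_card hsub
    have d2 := Finset.card_union_le (R x ∩ R y) (R z ∪ R y)ᶜ
    have d3 := Finset.card_compl (R z ∪ R y)
    rw [Fintype.card_fin] at d3
    have d4 := hn' (R z ∪ R y)
    omega
  have h5 : ∀ x z, (R x ∩ R z).Nonempty → 1000 * (R x \ R z).card < 140 * n := by
    rintro x z ⟨w, hw⟩
    obtain ⟨hw1, hw2⟩ := Finset.mem_inter.1 hw
    obtain ⟨q, hq, hwq⟩ := mem_NS.1 hw1
    obtain ⟨q', hq', hwq'⟩ := mem_NS.1 hw2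
    have e1 := mem_Delta.1 (hQs x hq)
    have e2 := mem_Delta.1 (hQs z hq')
    have a1 := h4 x q w e1.symm hwq
    have a2 := h4 w q' z hwq' e2.symm
    have hsub : R x \ R z ⊆ (R x \ R w) ∪ (R w \ R z) := by
      intro w hw
      simp only [Finset.mem_union, Finset.mem_sdiff] at *
      tauto
    have d1 := Finset.card_le_card hsub
    have d2 := Finset.card_union_le (R x \ R w) (R w \ R z)
    omega
  let x0 : Fin n := ⟨0, hn⟩
  refine ⟨Finset.univ.filter (fun z => (R z ∩ R x0).Nonempty), ?_, ?_⟩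
  · intro x hx y hy hxy
    by_contra hcon
    push Not at hcon
    have hN : NadjOn n E x y := ⟨hxy, by simpa using hcon.1, by simpa using hcon.2⟩
    have a1 := h5 x x0 (by simpa using hx)
    have a2 := h5 y x0 (by simpa using hy)
    have a3 := h3 x y hN
    have b1 := h1 x
    have b2 := h1 y
    have b3 := h2 x0
    have c1 := Finset.card_sdiff_add_card_inter (R x) (R x0)
    have c2 := Finset.card_sdiff_add_card_inter (R y) (R x0)
    have c3 := Finset.card_union_add_card_inter (R x ∩ R x0) (R y ∩ R x0)
    have c4 : ((R x ∩ R x0) ∪ (R y ∩ R x0)).card ≤ (R x0).card := Finset.card_le_card (by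
      intro w hw
      simp only [Finset.mem_union, Finset.mem_inter] at *
      tauto)
    have c5 : ((R x ∩ R x0) ∩ (R y ∩ R x0)).card ≤ (R x ∩ R y).card := Finset.card_le_card (by
      intro w hw
      simp only [Finset.mem_inter] at *
      tauto)
    omega
  · intro x hx y hy hxy
    by_contra hcon
    push Not at hcon
    have hN : NadjOn n E x y := ⟨hxy, by simpa using hcon.1, by simpa using hcon.2⟩
    have hx' : R x ∩ R x0 = ∅ := by simpa [Finset.not_nonempty_iff_eq_empty] using hx
    have hy' : R y ∩ R x0 = ∅ := by simpa [Finset.not_nonempty_iff_eq_empty] using hy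
    have a3 := h3 x y hN
    have b1 := h1 x
    have b2 := h1 y
    have b3 := h1 x0
    have c1 := Finset.card_union_add_card_inter (R x) (R y)
    have c2 := Finset.card_union_add_card_inter (R x ∪ R y) (R x0)
    have c3 : (R x ∪ R y) ∩ R x0 = ∅ := by
      rw [Finset.union_inter_distrib_right, hx', hy']; simp
    rw [c3] at c2
    have c4 := hn' ((R x ∪ R y) ∪ R x0)
    simp only [Finset.card_empty] at c2
    omega

/-- `2^(n/2)·3^(n/2)`-growth of bitournaments. -/
def extE {n : ℕ} (E : Fin n → Fin n → Bool) (c : Fin n → Bool × Bool) :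
    Fin (n + 1) → Fin (n + 1) → Bool := fun i j =>
  Fin.cases (Fin.cases false (fun b => (c b).1) j)
    (fun a => Fin.cases (c a).2 (fun b => E a b) j) i

def opt3 : Finset (Bool × Bool) := {(true, false), (false, true), (false, false)}
def opt2 : Finset (Bool × Bool) := {(true, false), (false, true)}

lemma Tset_fiber {n : ℕ} (E : Fin n → Fin n → Bool) (S : Finset (Fin n)) (hE : DigraphOn n E)
    (h1 : IndTournOn n E S) (h2 : IndTournOn n E Sᶜ) :
    2 ^ S.card * 3 ^ (n - S.card) ≤
      ((Tset (n + 1)).filter (fun E' => (fun a b : Fin n => E' a.succ b.succ) = E)).card := by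
  have hc : (Fintype.piFinset (fun j => if j ∈ S then opt2 else opt3)).card =
      2 ^ S.card * 3 ^ (n - S.card) := by
    rw [Fintype.card_piFinset]
    have : ∀ j, (if j ∈ S then opt2 else opt3).card = if j ∈ S then 2 else 3 := by
      intro j; split_ifs <;> rfl
    simp_rw [this]
    rw [Finset.prod_ite]
    simp only [Finset.prod_const]
    congr 2
    · congr 1; ext; simp
    · rw [Finset.filter_not]
      rw [Finset.card_sdiff_of_subset (Finset.filter_subset _ _)]
      simp
  rw [← hc]
  apply Finset.card_le_card_of_injOn (extE E)
  · intro c hcm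
    have hcm : ∀ j, c j ∈ if j ∈ S then opt2 else opt3 := Fintype.mem_piFinset.1 hcm
    have c3 : ∀ j, ¬ ((c j).1 = true ∧ (c j).2 = true) := by
      intro j
      have := hcm j
      rcases hcj : c j with ⟨p, q⟩
      rw [hcj] at this
      split_ifs at this <;> revert this <;> cases p <;> cases q <;> decide
    have c2 : ∀ j ∈ S, (c j).1 = true ∨ (c j).2 = true := by
      intro j hj
      have := hcm j
      rw [if_pos hj] at this
      rcases hcj : c j with ⟨p, q⟩
      rw [hcj] at this
      revert this; cases p <;> cases q <;> decide
    rw [Finset.mem_coe, Finset.mem_filter]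
    refine ⟨?_, ?_⟩
    · rw [Tset, Finset.mem_filter]
      refine ⟨Finset.mem_univ _, ⟨?_, ?_⟩, ?_⟩
      · intro x
        refine Fin.cases ?_ (fun a => ?_) x
        · rfl
        · exact hE.1 a
      · intro x y
        refine Fin.cases ?_ (fun a => ?_) x <;> refine Fin.cases ?_ (fun b => ?_) y
        · simp [extE]
        · have := c3 b
          simp only [extE, Fin.cases_zero, Fin.cases_succ]
          intro h; by_contra h'; exact this ⟨h, by simpa using h'⟩
        · have := c3 a
          simp only [extE, Fin.cases_zero, Fin.cases_succ]
          intro h; by_contra h'; exact this ⟨by simpa using h', h⟩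
        · exact hE.2 a b
      · refine ⟨insert 0 (S.image Fin.succ), ?_, ?_⟩
        · intro x hx y hy
          revert hx hy
          refine Fin.cases ?_ (fun a => ?_) x <;> refine Fin.cases ?_ (fun b => ?_) y
          · simp
          · intro _ hb _
            have hb : b ∈ S := by simpa using hb
            simpa [extE] using c2 b hb
          · intro ha _ _
            have ha : a ∈ S := by simpa using ha
            simpa [extE] using (c2 a ha).symm
          · intro ha hb hab
            have ha : a ∈ S := by simpa using ha
            have hb : b ∈ S := by simpa using hb
            exact h1 a ha b hb (fun h => hab (by rw [h]))
        · intro x hx y hy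
          revert hx hy
          refine Fin.cases ?_ (fun a => ?_) x <;> refine Fin.cases ?_ (fun b => ?_) y
          · simp
          · simp
          · simp
          · intro ha hb hab
            have ha : a ∈ Sᶜ := by simpa using ha
            have hb : b ∈ Sᶜ := by simpa using hb
            exact h2 a ha b hb (fun h => hab (by rw [h]))
    · rfl
  · intro c1 _ c2 _ h
    funext j
    have e1 := congrFun (congrFun h 0) j.succ
    have e2 := congrFun (congrFun h j.succ) 0
    simp only [extE, Fin.cases_zero, Fin.cases_succ] at e1 e2
    exact Prod.ext e1 e2

lemma Tset_succ (n : ℕ) :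
    (√6 : ℝ) ^ n * ((Tset n).card : ℝ) ≤ ((Tset (n + 1)).card : ℝ) := by
  have hmap : Set.MapsTo
      (fun (E : Fin (n + 1) → Fin (n + 1) → Bool) (a b : Fin n) => E a.succ b.succ)
      (Tset (n + 1) : Set (Fin (n + 1) → Fin (n + 1) → Bool))
      (Tset n : Set (Fin n → Fin n → Bool)) := by
    intro E hE
    rw [Finset.mem_coe] at hE ⊢
    simp only [Tset, Finset.mem_filter, Finset.mem_univ, true_and] at hE ⊢
    obtain ⟨⟨a1, a2⟩, S, b1, b2⟩ := hE
    refine ⟨⟨fun x => a1 _, fun x y => a2 _ _⟩, Finset.univ.filter (fun i => i.succ ∈ S), ?_, ?_⟩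
    · intro x hx y hy hxy
      exact b1 _ (by simpa using hx) _ (by simpa using hy) (by simpa using hxy)
    · intro x hx y hy hxy
      exact b2 _ (by simpa using hx) _ (by simpa using hy) (by simpa using hxy)
  rw [Finset.card_eq_sum_card_fiberwise hmap]
  push_cast
  refine (le_of_eq (by rw [nsmul_eq_mul]; ring)).trans
    (Finset.card_nsmul_le_sum (Tset n) _ ((√6 : ℝ) ^ n) ?_)
  intro E hE
  simp only [Tset, Finset.mem_filter, Finset.mem_univ, true_and] at hE
  obtain ⟨hD, S, b1, b2⟩ := hE
  have key : ∀ s n : ℕ, 2 * s ≤ n →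
      (√6 : ℝ) ^ n ≤ ((2 ^ s * 3 ^ (n - s) : ℕ) : ℝ) := by
    intro s n hS
    obtain ⟨d, hd⟩ := Nat.exists_eq_add_of_le hS
    have h6 : (√6 : ℝ) ^ 2 = 6 := Real.sq_sqrt (by norm_num)
    have h63 : (√6 : ℝ) ≤ 3 := Real.sqrt_le_iff.2 (by norm_num)
    have : n - s = s + d := by omega
    rw [this, hd, pow_add, pow_mul, h6]
    push_cast
    rw [pow_add, ← mul_assoc, ← mul_pow]
    norm_num
    gcongr
  have hcS : Sᶜ.card = n - S.card := by rw [Finset.card_compl, Fintype.card_fin]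
  by_cases hS : 2 * S.card ≤ n
  · exact (key _ n hS).trans (by exact_mod_cast Tset_fiber E S hD b1 b2)
  · exact (key Sᶜ.card n (by omega)).trans (by
      exact_mod_cast Tset_fiber E Sᶜ hD b2 (by rw [compl_compl]; exact b1))

lemma Tset_add (k : ℕ) : ∃ D : ℝ, 0 < D ∧ ∀ n, k ≤ n →
    (√6 : ℝ) ^ (k * n) * ((Tset (n - k)).card : ℝ) ≤ D * ((Tset n).card : ℝ) := by
  induction k with
  | zero => exact ⟨1, one_pos, fun n _ => by simp⟩
  | succ k ih =>
    obtain ⟨D, hD, h⟩ := ih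
    have hs : (0 : ℝ) < √6 := by positivity
    refine ⟨(√6) ^ (k + 1) * D, by positivity, fun n hn => ?_⟩
    obtain ⟨m, rfl⟩ := Nat.exists_eq_add_of_le hn
    have h1 := h (k + 1 + m) (by omega)
    have h2 := Tset_succ m
    have e1 : k + 1 + m - k = m + 1 := by omega
    have e2 : k + 1 + m - (k + 1) = m := by omega
    rw [e1] at h1
    rw [e2]
    calc (√6 : ℝ) ^ ((k + 1) * (k + 1 + m)) * ((Tset m).card : ℝ)
        = √6 ^ (k + 1) * (√6 ^ (k * (k + 1 + m)) * (√6 ^ m * ((Tset m).card : ℝ))) := by ring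
      _ ≤ √6 ^ (k + 1) * (√6 ^ (k * (k + 1 + m)) * ((Tset (m + 1)).card : ℝ)) := by gcongr
      _ ≤ √6 ^ (k + 1) * (D * ((Tset (k + 1 + m)).card : ℝ)) := by gcongr
      _ = _ := by ring

lemma Tset_pos (n : ℕ) : 1 ≤ (Tset n).card := by
  induction n with
  | zero =>
    apply Finset.card_pos.2
    refine ⟨fun _ _ => false, ?_⟩
    rw [Tset, Finset.mem_filter]
    exact ⟨Finset.mem_univ _, ⟨fun x => x.elim0, fun x => x.elim0⟩, ∅, fun x => x.elim0,
      fun x => x.elim0⟩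
  | succ n ih =>
    have h := Tset_succ n
    have : (0 : ℝ) < (√6 : ℝ) ^ n * ((Tset n).card : ℝ) := by
      have : (0 : ℝ) < (Tset n).card := by exact_mod_cast ih
      positivity
    have := this.trans_le h
    exact_mod_cast this

lemma union_bound {α ι : Type*} [Fintype ι] (X : Finset α) (Y : ι → Finset α) (M : ℝ)
    (h : ∀ x ∈ X, ∃ i, x ∈ Y i) (hM : ∀ i, ((Y i).card : ℝ) ≤ M) :
    (X.card : ℝ) ≤ Fintype.card ι * M := by
  have h1 : X ⊆ Finset.univ.biUnion Y := fun x hx => by simpa using h x hx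
  have h2 := (Finset.card_le_card h1).trans Finset.card_biUnion_le
  calc (X.card : ℝ) ≤ ((∑ i, (Y i).card : ℕ) : ℝ) := by exact_mod_cast h2
    _ = ∑ i, ((Y i).card : ℝ) := by push_cast; rfl
    _ ≤ ∑ _i : ι, M := Finset.sum_le_sum (fun i _ => hM i)
    _ = _ := by simp

lemma mem_opt3 {n : ℕ} {E : Fin n → Fin n → Bool} (hE : DigraphOn n E) (u v : Fin n) :
    (E u v, E v u) ∈ opt3 := by
  have := hE.2 u v
  revert this
  generalize E u v = p
  generalize E v u = q
  revert p q
  decide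

lemma mem_opt2 {n : ℕ} {E : Fin n → Fin n → Bool} (hE : DigraphOn n E) {u v : Fin n}
    (huv : v ≠ u) (h : ¬ NadjOn n E v u) :
    (E u v, E v u) ∈ opt2 := by
  have := hE.2 u v
  have h' : ¬ (E v u = false ∧ E u v = false) := fun h' => h ⟨huv, h'⟩
  revert this h'
  generalize E u v = p
  generalize E v u = q
  revert p q
  decide

lemma prod_ite_pow {m : ℕ} (A : Finset (Fin m)) (a : ℝ) :
    (∏ j, if j ∈ A then a else 1) = a ^ A.card := by
  rw [Finset.prod_ite]; simp

lemma count_NS {n k : ℕ} (ψ : Fin k → Fin n) (hψ : Function.Injective ψ) (R : Finset (Fin n)) :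
    (((Fset n).filter (fun E => NS n E (Finset.univ.image ψ) ⊆ R)).card : ℝ) ≤
      (2 : ℝ) ^ (k * k) * ((2 : ℝ) ^ (k * n) * (3 / 2 : ℝ) ^ (k * R.card)) *
        ((Fset (n - k)).card : ℝ) := by
  obtain ⟨φ, hφ, hcov, hne⟩ := exists_compl ψ hψ
  refine core_count φ ψ hφ hcov _ (Finset.filter_subset _ _)
    (fun _ j => if φ j ∈ R then Fintype.piFinset (fun _ : Fin k => opt3)
      else Fintype.piFinset (fun _ : Fin k => opt2)) _ (by positivity) ?_ ?_
  · intro E hE j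
    obtain ⟨hE, hR⟩ := Finset.mem_filter.1 hE
    have hD : DigraphOn n E := by
      simp only [Fset, Finset.mem_filter, Finset.mem_univ, true_and] at hE
      exact hE.1
    split_ifs with hj
    · rw [Fintype.mem_piFinset]
      intro i
      exact mem_opt3 hD _ _
    · rw [Fintype.mem_piFinset]
      intro i
      apply mem_opt2 hD (hne j i)
      intro h
      exact hj (hR (mem_NS.2 ⟨ψ i, by simp, h⟩))
  · intro E _
    have h1 : ∀ j, (((if φ j ∈ R then Fintype.piFinset (fun _ : Fin k => opt3)
      else Fintype.piFinset (fun _ : Fin k => opt2)).card : ℕ) : ℝ) =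
        (2 : ℝ) ^ k * (if j ∈ Finset.univ.filter (fun j => φ j ∈ R) then (3 / 2 : ℝ) ^ k else 1) := by
      intro j
      have e3 : opt3.card = 3 := rfl
      have e2 : opt2.card = 2 := rfl
      by_cases hj : φ j ∈ R
      · simp only [hj, if_true, Finset.mem_filter, Finset.mem_univ, true_and,
          Fintype.card_piFinset, e3, Finset.prod_const, Finset.card_univ, Fintype.card_fin]
        rw [← mul_pow]; norm_num
      · simp only [hj, if_false, Finset.mem_filter, Finset.mem_univ, true_and,
          Fintype.card_piFinset, e2, Finset.prod_const, Finset.card_univ, Fintype.card_fin]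
        norm_num
    rw [Nat.cast_prod, Finset.prod_congr rfl (fun j _ => h1 j), Finset.prod_mul_distrib,
      prod_ite_pow]
    simp only [Finset.prod_const, Finset.card_univ, Fintype.card_fin]
    rw [← pow_mul, ← pow_mul]
    have hc : (Finset.univ.filter (fun j => φ j ∈ R)).card ≤ R.card := by
      apply Finset.card_le_card_of_injOn φ
      · intro j hj; simpa using hj
      · exact hφ.injOn
    gcongr
    · norm_num
    · omega
    · norm_num

noncomputable def clsA (n k : ℕ) : Finset (Fin n → Fin n → Bool) :=
  (Fset n).filter (fun E => ∃ v, (DeltaOn n E v).card < k + 2)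

noncomputable def clsB (n k : ℕ) : Finset (Fin n → Fin n → Bool) :=
  (Fset n).filter (fun E => ∃ P : Finset (Fin n), P.card = k ∧ 1000 * (NS n E P).card ≤ 499 * n)

def condC (n : ℕ) (E : Fin n → Fin n → Bool) (x y : Fin n) (P P' : Finset (Fin n)) : Prop :=
  NadjOn n E x y ∧ P ⊆ DeltaOn n E x ∧ P' ⊆ DeltaOn n E y ∧ y ∉ P ∧ x ∉ P' ∧
  499 * n < 1000 * (NS n E P).card ∧ 499 * n < 1000 * (NS n E P').card ∧
  n ≤ 100 * (NS n E P ∩ NS n E P').card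

noncomputable def clsC (n k : ℕ) : Finset (Fin n → Fin n → Bool) :=
  (Fset n).filter (fun E => ∃ x y, ∃ p p' : Fin (k + 1) → Fin n,
    condC n E x y (Finset.univ.image p) (Finset.univ.image p'))

lemma cardA (n k : ℕ) : ((clsA n k).card : ℝ) ≤
    (2 * (3 / 2 : ℝ) ^ (k + 1)) * (n : ℝ) ^ (k + 2) * (2 : ℝ) ^ n * ((Fset (n - 1)).card : ℝ) := by
  have := union_bound (clsA n k)
    (fun vp : Fin n × (Fin (k + 1) → Fin n) => (Fset n).filter
      (fun E => NS n E (Finset.univ.image (fun _ : Fin 1 => vp.1)) ⊆ Finset.univ.image vp.2))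
    ((2 : ℝ) ^ (1 * 1) * ((2 : ℝ) ^ (1 * n) * (3 / 2 : ℝ) ^ (k + 1)) *
        ((Fset (n - 1)).card : ℝ)) ?_ ?_
  · refine this.trans (le_of_eq ?_)
    simp only [Fintype.card_prod, Fintype.card_fun, Fintype.card_fin]
    push_cast
    ring
  · intro E hE
    obtain ⟨hE, v, hv⟩ := Finset.mem_filter.1 hE
    have : ∃ p : Fin (k + 1) → Fin n, DeltaOn n E v ⊆ Finset.univ.image p := by
      rcases (DeltaOn n E v).eq_empty_or_nonempty with h | h
      · exact ⟨fun _ => v, by simp [h]⟩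
      · obtain ⟨p, hp⟩ := exists_image _ h (show _ ≤ k + 1 by omega)
        exact ⟨p, hp.ge⟩
    obtain ⟨p, hp⟩ := this
    refine ⟨(v, p), Finset.mem_filter.2 ⟨hE, ?_⟩⟩
    intro w hw
    obtain ⟨q, hq, hwq⟩ := mem_NS.1 hw
    have : q = v := by
      obtain ⟨_, _, h⟩ := Finset.mem_image.1 hq
      exact h.symm
    subst this
    exact hp (mem_Delta.2 hwq)
  · rintro ⟨v, p⟩
    refine (count_NS (fun _ : Fin 1 => v) (fun _ _ _ => Subsingleton.elim _ _) _).trans ?_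
    have : (Finset.univ.image p).card ≤ k + 1 := Finset.card_image_le.trans (by simp)
    gcongr
    · norm_num
    · simpa using this

lemma cardB (n k : ℕ) (L : ℕ) (hL : ∀ r, 1000 * r ≤ 499 * n → k * r ≤ L) :
    ((clsB n k).card : ℝ) ≤
    (2 : ℝ) ^ (k * k) * (n : ℝ) ^ k * (2 : ℝ) ^ n * ((2 : ℝ) ^ (k * n) * (3 / 2 : ℝ) ^ L) *
      ((Fset (n - k)).card : ℝ) := by
  have := union_bound (clsB n k)
    (fun ψR : (Fin k → Fin n) × Finset (Fin n) => (Fset n).filter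
      (fun E => Function.Injective ψR.1 ∧ k * ψR.2.card ≤ L ∧
        NS n E (Finset.univ.image ψR.1) ⊆ ψR.2))
    ((2 : ℝ) ^ (k * k) * ((2 : ℝ) ^ (k * n) * (3 / 2 : ℝ) ^ L) *
        ((Fset (n - k)).card : ℝ)) ?_ ?_
  · refine this.trans (le_of_eq ?_)
    simp only [Fintype.card_prod, Fintype.card_fun, Fintype.card_fin, Fintype.card_finset]
    push_cast
    ring
  · intro E hE
    obtain ⟨hE, P, hP, hPc⟩ := Finset.mem_filter.1 hE
    refine ⟨(P.orderEmbOfFin hP, NS n E P), Finset.mem_filter.2 ⟨hE, ?_, hL _ hPc, ?_⟩⟩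
    · exact (P.orderEmbOfFin hP).injective
    · have : Finset.univ.image (P.orderEmbOfFin hP) = P := by
        apply Finset.coe_injective; simp
      rw [this]
  · rintro ⟨ψ, R⟩
    by_cases h : Function.Injective ψ ∧ k * R.card ≤ L
    · refine le_trans ?_ ((count_NS ψ h.1 R).trans ?_)
      · norm_cast
        apply Finset.card_le_card
        intro E hE
        rw [Finset.mem_filter] at hE ⊢
        exact ⟨hE.1, hE.2.2.2⟩
      · have := h.2
        gcongr
        norm_num
    · have : ((Fset n).filter
      (fun E => Function.Injective ψ ∧ k * R.card ≤ L ∧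
        NS n E (Finset.univ.image ψ) ⊆ R)) = ∅ := by
        apply Finset.filter_eq_empty_iff.2
        intro E _ hh
        exact h ⟨hh.1, hh.2.1⟩
      simp only [this]
      simp only [Finset.card_empty, Nat.cast_zero]
      positivity

def okc (p q : Bool) (c : Fin 2 → Bool × Bool) : Bool :=
  (!((c 0).1 && (c 0).2)) && (!((c 1).1 && (c 1).2)) &&
  ((c 0).1 || (c 0).2 || (c 1).1 || (c 1).2) &&
  (!p || (c 0).1 || (c 0).2) && (!q || (c 1).1 || (c 1).2)

def optC (p q : Bool) : Finset (Fin 2 → Bool × Bool) := Finset.univ.filter (fun c => okc p q c = true)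

lemma mem_optC {p q : Bool} {c : Fin 2 → Bool × Bool} : c ∈ optC p q ↔ okc p q c = true := by
  rw [optC, Finset.mem_filter]
  exact ⟨fun h => h.2, fun h => ⟨Finset.mem_univ _, h⟩⟩

lemma okc_mk {n : ℕ} (E : Fin n → Fin n → Bool) (x y z : Fin n) (p q : Bool) :
    okc p q (fun i => (E (![x, y] i) z, E z (![x, y] i))) =
      ((!(E x z && E z x)) && (!(E y z && E z y)) &&
      (E x z || E z x || E y z || E z y) &&
      (!p || E x z || E z x) && (!q || E y z || E z y)) := rfl

lemma optC_card : (optC true true).card = 4 ∧ (optC true false).card = 6 ∧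
    (optC false true).card = 6 ∧ (optC false false).card = 8 := by
  refine ⟨?_, ?_, ?_, ?_⟩ <;> decide

/-- neighbourhood of P seen through φ -/
def seen {n m : ℕ} (φ : Fin m → Fin n) (P : Finset (Fin n)) (E' : Fin m → Fin m → Bool)
    (j : Fin m) : Prop := ∃ j', φ j' ∈ P ∧ NadjOn m E' j j'

lemma seen_iff {n m : ℕ} (φ : Fin m → Fin n) (hφ : Function.Injective φ) (P : Finset (Fin n))
    (E : Fin n → Fin n → Bool) (hP : ∀ v ∈ P, ∃ j, φ j = v) (j : Fin m) :
    seen φ P (fun a b => E (φ a) (φ b)) j ↔ φ j ∈ NS n E P := by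
  rw [mem_NS]
  constructor
  · rintro ⟨j', h1, h2, h3⟩
    exact ⟨φ j', h1, hφ.ne h2, h3⟩
  · rintro ⟨q, hq, h2, h3⟩
    obtain ⟨j', rfl⟩ := hP q hq
    exact ⟨j', hq, fun h => h2 (by rw [h]), h3⟩

lemma card_pre {n : ℕ} (φ : Fin (n - 2) → Fin n) (x y : Fin n)
    (hcov : ∀ v, (∃ j, φ j = v) ∨ ∃ i : Fin 2, ![x, y] i = v) (A : Finset (Fin n)) :
    A.card ≤ (Finset.univ.filter (fun j => φ j ∈ A)).card + 2 := by
  have : A ⊆ (Finset.univ.filter (fun j => φ j ∈ A)).image φ ∪ {x, y} := by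
    intro v hv
    rcases hcov v with ⟨j, rfl⟩ | ⟨i, rfl⟩
    · apply Finset.mem_union_left
      exact Finset.mem_image_of_mem _ (by simpa using hv)
    · apply Finset.mem_union_right
      fin_cases i <;> simp
  have h1 := Finset.card_le_card this
  have h2 := Finset.card_union_le ((Finset.univ.filter (fun j => φ j ∈ A)).image φ) {x, y}
  have h3 := Finset.card_image_le (s := Finset.univ.filter (fun j => φ j ∈ A)) (f := φ)
  have h4 := Finset.card_le_two (a := x) (b := y)
  omega

lemma pow_le_rpow_of {a : ℝ} (h0 : 0 < a) (h1 : a ≤ 1) {r : ℕ} {t : ℝ} (h : t ≤ r) :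
    a ^ r ≤ a ^ t := by
  rw [← Real.rpow_natCast]
  exact Real.rpow_le_rpow_of_exponent_ge h0 h1 h

lemma count_C {n : ℕ} (x y : Fin n) (P P' : Finset (Fin n)) :
    (((Fset n).filter (fun E => condC n E x y P P')).card : ℝ) ≤
      (2 : ℝ) ^ (2 * 2) * ((8 : ℝ) ^ n * (3 / 4 : ℝ) ^ (499 / 1000 * (n : ℝ) - 2) *
        (3 / 4 : ℝ) ^ (499 / 1000 * (n : ℝ) - 2) * (8 / 9 : ℝ) ^ (1 / 100 * (n : ℝ) - 2)) *
        ((Fset (n - 2)).card : ℝ) := by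
  by_cases hxy : x = y
  · have : ((Fset n).filter (fun E => condC n E x y P P')) = ∅ := by
      apply Finset.filter_eq_empty_iff.2
      intro E _ hh
      exact hh.1.1 hxy
    rw [this]
    simp only [Finset.card_empty, Nat.cast_zero]
    positivity
  have hψ : Function.Injective ![x, y] := by
    intro a b h
    fin_cases a <;> fin_cases b <;> simp_all
  obtain ⟨φ, hφ, hcov, hne⟩ := exists_compl ![x, y] hψ
  have hnex : ∀ j, φ j ≠ x := fun j => hne j 0
  have hney : ∀ j, φ j ≠ y := fun j => hne j 1
  have hin : ∀ E ∈ (Fset n).filter (fun E => condC n E x y P P'),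
      (∀ v ∈ P, ∃ j, φ j = v) ∧ (∀ v ∈ P', ∃ j, φ j = v) := by
    intro E hE
    obtain ⟨hE, h1, h2, h3, h4, h5, -⟩ := Finset.mem_filter.1 hE
    constructor
    · intro v hv
      rcases hcov v with h | ⟨i, hi⟩
      · exact h
      · exfalso
        have := mem_Delta.1 (h2 hv)
        fin_cases i
        · exact this.1 hi.symm
        · exact h4 (by simp at hi; rwa [hi])
    · intro v hv
      rcases hcov v with h | ⟨i, hi⟩
      · exact h
      · exfalso
        have := mem_Delta.1 (h3 hv)
        fin_cases i
        · exact h5 (by simp at hi; rwa [hi])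
        · exact this.1 hi.symm
  refine core_count φ ![x, y] hφ hcov _ (Finset.filter_subset _ _)
    (fun E' j => optC (decide (seen φ P E' j)) (decide (seen φ P' E' j))) _ (by positivity) ?_ ?_
  · intro E hE j
    have hs1 := seen_iff φ hφ P E (hin E hE).1 j
    have hs2 := seen_iff φ hφ P' E (hin E hE).2 j
    obtain ⟨hE, h1, h2, h3, h4, h5, -⟩ := Finset.mem_filter.1 hE
    simp only [Fset, Finset.mem_filter, Finset.mem_univ, true_and] at hE
    obtain ⟨hD, hI⟩ := hE
    have t1 := hD.2 x (φ j)
    have t2 := hD.2 y (φ j)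
    have t3 := hI x y (φ j) hxy (hney j).symm (hnex j).symm
    rw [h1.2.1, h1.2.2] at t3
    -- common neighbour argument
    have nox : ∀ (z : Fin n) (Q : Finset (Fin n)), φ j ≠ z → Q ⊆ DeltaOn n E z →
        φ j ∈ NS n E Q → E z (φ j) = true ∨ E (φ j) z = true := by
      intro z Q hz hQ hj
      obtain ⟨q, hq, hjq⟩ := mem_NS.1 hj
      have hqz := mem_Delta.1 (hQ hq)
      have := hI z q (φ j) hqz.1.symm hjq.1.symm hz.symm
      rw [hqz.2.1, hqz.2.2, hjq.2.1, hjq.2.2] at this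
      simpa using this
    have t4 := fun h => nox x P (hnex j) h2 (hs1.1 h)
    have t5 := fun h => nox y P' (hney j) h3 (hs2.1 h)
    refine mem_optC.2 ?_
    rw [okc_mk]
    by_cases s1 : seen φ P (fun a b => E (φ a) (φ b)) j <;>
    by_cases s2 : seen φ P' (fun a b => E (φ a) (φ b)) j <;>
    simp only [s1, s2, decide_true, decide_false, true_implies, false_implies] at t4 t5 ⊢ <;>
    clear hs1 hs2 nox hin s1 s2 <;>
    revert t1 t2 t3 t4 t5 <;>
    generalize E x (φ j) = a <;> generalize E (φ j) x = b <;>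
    generalize E y (φ j) = c <;> generalize E (φ j) y = d <;>
    revert a b c d <;> decide
  · intro E hE
    have hs1 := seen_iff φ hφ P E (hin E hE).1
    have hs2 := seen_iff φ hφ P' E (hin E hE).2
    obtain ⟨hE, -, -, -, -, -, c1, c2, c3⟩ := Finset.mem_filter.1 hE
    set A := Finset.univ.filter (fun j => φ j ∈ NS n E P) with hA
    set B := Finset.univ.filter (fun j => φ j ∈ NS n E P') with hB
    set C := Finset.univ.filter (fun j => φ j ∈ NS n E P ∩ NS n E P') with hC
    have a1 := card_pre φ x y hcov (NS n E P)
    have a2 := card_pre φ x y hcov (NS n E P')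
    have a3 := card_pre φ x y hcov (NS n E P ∩ NS n E P')
    rw [← hA] at a1
    rw [← hB] at a2
    rw [← hC] at a3
    have h1 : ∀ j, (((optC (decide (seen φ P (fun a b => E (φ a) (φ b)) j))
        (decide (seen φ P' (fun a b => E (φ a) (φ b)) j))).card : ℕ) : ℝ) =
        (8 : ℝ) * (if j ∈ A then (3 / 4 : ℝ) else 1) * (if j ∈ B then (3 / 4 : ℝ) else 1) *
          (if j ∈ C then (8 / 9 : ℝ) else 1) := by
      intro j
      have mA : j ∈ A ↔ φ j ∈ NS n E P := by simp [hA]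
      have mB : j ∈ B ↔ φ j ∈ NS n E P' := by simp [hB]
      have mC : j ∈ C ↔ φ j ∈ NS n E P ∧ φ j ∈ NS n E P' := by simp [hC]
      simp only [mA, mB, mC, hs1, hs2]
      by_cases s1 : φ j ∈ NS n E P <;> by_cases s2 : φ j ∈ NS n E P' <;>
      simp only [s1, s2, decide_true, decide_false, optC_card.1, optC_card.2.1, optC_card.2.2.1,
        optC_card.2.2.2, and_true, and_false, if_true, if_false] <;> norm_num
    rw [Nat.cast_prod, Finset.prod_congr rfl (fun j _ => h1 j), Finset.prod_mul_distrib,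
      Finset.prod_mul_distrib, Finset.prod_mul_distrib, prod_ite_pow, prod_ite_pow, prod_ite_pow]
    simp only [Finset.prod_const, Finset.card_univ, Fintype.card_fin]
    have c1' : (499 * n : ℝ) < 1000 * (NS n E P).card := by exact_mod_cast c1
    have c2' : (499 * n : ℝ) < 1000 * (NS n E P').card := by exact_mod_cast c2
    have c3' : (n : ℝ) ≤ 100 * (NS n E P ∩ NS n E P').card := by exact_mod_cast c3
    have a1' : ((NS n E P).card : ℝ) ≤ A.card + 2 := by exact_mod_cast a1
    have a2' : ((NS n E P').card : ℝ) ≤ B.card + 2 := by exact_mod_cast a2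
    have a3' : ((NS n E P ∩ NS n E P').card : ℝ) ≤ C.card + 2 := by exact_mod_cast a3
    have p1 : (3 / 4 : ℝ) ^ A.card ≤ (3 / 4 : ℝ) ^ (499 / 1000 * (n : ℝ) - 2) :=
      pow_le_rpow_of (by norm_num) (by norm_num) (by linarith)
    have p2 : (3 / 4 : ℝ) ^ B.card ≤ (3 / 4 : ℝ) ^ (499 / 1000 * (n : ℝ) - 2) :=
      pow_le_rpow_of (by norm_num) (by norm_num) (by linarith)
    have p3 : (8 / 9 : ℝ) ^ C.card ≤ (8 / 9 : ℝ) ^ (1 / 100 * (n : ℝ) - 2) :=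
      pow_le_rpow_of (by norm_num) (by norm_num) (by linarith)
    have p0 : (8 : ℝ) ^ (n - 2) ≤ 8 ^ n := pow_le_pow_right₀ (by norm_num) (by omega)
    gcongr

/-- the decay rate for class C -/
noncomputable def rhoC : ℝ := (4 / 3 : ℝ) ^ (2 / 1000 : ℝ) * (8 / 9 : ℝ) ^ (1 / 100 : ℝ)

lemma rhoC_eq : ∃ D : ℝ, 0 < D ∧ ∀ n : ℕ,
    ((8 : ℝ) ^ n * (3 / 4 : ℝ) ^ (499 / 1000 * (n : ℝ) - 2) *
        (3 / 4 : ℝ) ^ (499 / 1000 * (n : ℝ) - 2) * (8 / 9 : ℝ) ^ (1 / 100 * (n : ℝ) - 2)) =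
      D * 6 ^ n * rhoC ^ n := by
  refine ⟨(3 / 4 : ℝ) ^ (-2 : ℝ) * (3 / 4 : ℝ) ^ (-2 : ℝ) * (8 / 9 : ℝ) ^ (-2 : ℝ), by positivity, ?_⟩
  intro n
  have e0 : (4 / 3 : ℝ) = (3 / 4 : ℝ) ^ (-1 : ℝ) := by rw [Real.rpow_neg_one]; norm_num
  have e1 : (3 / 4 : ℝ) ^ (499 / 1000 * (n : ℝ) - 2) =
      ((3 / 4 : ℝ) ^ (499 / 1000 : ℝ)) ^ n * (3 / 4 : ℝ) ^ (-2 : ℝ) := by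
    rw [sub_eq_add_neg, Real.rpow_add (by norm_num), Real.rpow_mul_natCast (by norm_num)]
  have e2 : (8 / 9 : ℝ) ^ (1 / 100 * (n : ℝ) - 2) =
      ((8 / 9 : ℝ) ^ (1 / 100 : ℝ)) ^ n * (8 / 9 : ℝ) ^ (-2 : ℝ) := by
    rw [sub_eq_add_neg, Real.rpow_add (by norm_num), Real.rpow_mul_natCast (by norm_num)]
  have e3 : (8 : ℝ) * (3 / 4 : ℝ) ^ (499 / 1000 : ℝ) * (3 / 4 : ℝ) ^ (499 / 1000 : ℝ) =
      6 * (4 / 3 : ℝ) ^ (2 / 1000 : ℝ) := by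
    rw [e0, ← Real.rpow_mul (by norm_num), mul_assoc, ← Real.rpow_add (by norm_num)]
    have : (499 / 1000 + 499 / 1000 : ℝ) = 1 + -1 * (2 / 1000) := by norm_num
    rw [this, Real.rpow_add (by norm_num), Real.rpow_one]
    ring
  rw [e1, e2, rhoC]
  calc _ = ((8 : ℝ) * (3 / 4 : ℝ) ^ (499 / 1000 : ℝ) * (3 / 4 : ℝ) ^ (499 / 1000 : ℝ)) ^ n *
        ((8 / 9 : ℝ) ^ (1 / 100 : ℝ)) ^ n *
        ((3 / 4 : ℝ) ^ (-2 : ℝ) * (3 / 4 : ℝ) ^ (-2 : ℝ) * (8 / 9 : ℝ) ^ (-2 : ℝ)) := by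
        rw [mul_pow, mul_pow]; ring
    _ = _ := by rw [e3, mul_pow, mul_pow]; ring

lemma cardC (k : ℕ) : ∃ D : ℝ, 0 < D ∧ ∀ n : ℕ, ((clsC n k).card : ℝ) ≤
    D * (n : ℝ) ^ (2 * k + 4) * (6 ^ n * rhoC ^ n) * ((Fset (n - 2)).card : ℝ) := by
  obtain ⟨D, hD, h⟩ := rhoC_eq
  refine ⟨2 ^ (2 * 2) * D, by positivity, fun n => ?_⟩
  have := union_bound (clsC n k)
    (fun t : (Fin n × Fin n) × ((Fin (k + 1) → Fin n) × (Fin (k + 1) → Fin n)) => (Fset n).filter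
      (fun E => condC n E t.1.1 t.1.2 (Finset.univ.image t.2.1) (Finset.univ.image t.2.2)))
    (2 ^ (2 * 2) * (D * 6 ^ n * rhoC ^ n) * ((Fset (n - 2)).card : ℝ)) ?_ ?_
  · refine this.trans (le_of_eq ?_)
    simp only [Fintype.card_prod, Fintype.card_fun, Fintype.card_fin]
    push_cast
    ring
  · intro E hE
    obtain ⟨hE, x, y, p, p', hh⟩ := Finset.mem_filter.1 hE
    exact ⟨((x, y), (p, p')), Finset.mem_filter.2 ⟨hE, hh⟩⟩
  · rintro ⟨⟨x, y⟩, ⟨p, p'⟩⟩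
    have := count_C x y (Finset.univ.image p) (Finset.univ.image p')
    rw [h n] at this
    exact this

lemma Fset_split (n k : ℕ) (hn : 1 ≤ n) (hk : 1 ≤ k) :
    (Fset n).card ≤ (Tset n).card + (clsA n k).card + (clsB n k).card + (clsC n k).card := by
  have hsub : Fset n ⊆ Tset n ∪ clsA n k ∪ clsB n k ∪ clsC n k := by
    intro E hE
    by_contra hcon
    simp only [Finset.mem_union, not_or] at hcon
    obtain ⟨⟨⟨hT, hA⟩, hB⟩, hC⟩ := hcon
    have hA : ∀ v, k + 2 ≤ (DeltaOn n E v).card := by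
      intro v
      by_contra h
      exact hA (Finset.mem_filter.2 ⟨hE, v, by omega⟩)
    have hB : ∀ P : Finset (Fin n), P.card = k → 499 * n < 1000 * (NS n E P).card := by
      intro P hP
      by_contra h
      exact hB (Finset.mem_filter.2 ⟨hE, P, hP, by omega⟩)
    have hB' : ∀ P : Finset (Fin n), k ≤ P.card → 499 * n < 1000 * (NS n E P).card := by
      intro P hP
      obtain ⟨P0, h0, h0c⟩ := Finset.exists_subset_card_eq hP
      have := hB P0 h0c
      have := Finset.card_le_card (NS_mono (E := E) h0)
      omega
    have hS := structural E hn hk hA hB (by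
      intro x y hxy P P' h1 h2 h3 h4 h5 h6 h7 h8
      by_contra h
      obtain ⟨p, rfl⟩ := exists_image P (Finset.card_pos.1 (by omega)) h7
      obtain ⟨p', rfl⟩ := exists_image P' (Finset.card_pos.1 (by omega)) h8
      exact hC (Finset.mem_filter.2 ⟨hE, x, y, p, p', hxy, h1, h2, h3, h4, hB' _ h5, hB' _ h6,
        by omega⟩))
    apply hT
    simp only [Fset, Tset, Finset.mem_filter, Finset.mem_univ, true_and] at hE ⊢
    exact ⟨hE.1, hS⟩
  have h1 := Finset.card_le_card hsub
  have h2 := Finset.card_union_le (Tset n ∪ clsA n k ∪ clsB n k) (clsC n k)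
  have h3 := Finset.card_union_le (Tset n ∪ clsA n k) (clsB n k)
  have h4 := Finset.card_union_le (Tset n) (clsA n k)
  omega

/-- the constant of the theorem -/
noncomputable def etaC : ℝ := (2 : ℝ) ^ ((1 : ℝ) / 3000)

lemma etaC_pos : 0 < etaC := by unfold etaC; positivity

lemma etaC_pow : etaC ^ 3000 = 2 := by
  rw [etaC, ← Real.rpow_natCast, ← Real.rpow_mul (by norm_num)]
  norm_num

lemma etaC_one_le : 1 ≤ etaC := Real.one_le_rpow (by norm_num) (by norm_num)

lemma etaC_lt : etaC < 9 / 8 := by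
  by_contra h
  push Not at h
  have h1 : (9 / 8 : ℝ) ^ 8 ≤ etaC ^ 8 := pow_le_pow_left₀ (by norm_num) h 8
  have h2 : etaC ^ 8 ≤ etaC ^ 3000 := pow_le_pow_right₀ etaC_one_le (by norm_num)
  rw [etaC_pow] at h2
  norm_num at h1
  linarith

lemma rhoC_eta : rhoC * etaC < 1 := by
  have h0 : 0 ≤ rhoC * etaC := by have := etaC_pos; unfold rhoC; positivity
  rw [← pow_lt_one_iff_of_nonneg h0 (n := 3000) (by norm_num), mul_pow, etaC_pow, rhoC, mul_pow]
  have e1 : ((4 / 3 : ℝ) ^ (2 / 1000 : ℝ)) ^ 3000 = (4 / 3 : ℝ) ^ 6 := by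
    rw [← Real.rpow_natCast, ← Real.rpow_mul (by norm_num), ← Real.rpow_natCast]
    norm_num
  have e2 : ((8 / 9 : ℝ) ^ (1 / 100 : ℝ)) ^ 3000 = (8 / 9 : ℝ) ^ 30 := by
    rw [← Real.rpow_natCast, ← Real.rpow_mul (by norm_num), ← Real.rpow_natCast]
    norm_num
  rw [e1, e2]
  norm_num

def Good (cls : ℕ → ℕ) (j : ℕ) : Prop :=
  ∃ (D : ℝ) (p : ℕ) (ρ : ℝ), 0 ≤ ρ ∧ ρ * etaC < 1 ∧ ∀ n, j ≤ n → ∀ K : ℝ,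
    ((Fset (n - j)).card : ℝ) ≤ K * ((Tset (n - j)).card : ℝ) →
    (cls n : ℝ) ≤ D * (n : ℝ) ^ p * ρ ^ n * (K * ((Tset n).card : ℝ))

lemma good_of (cls : ℕ → ℕ) (j p : ℕ) (D ρ : ℝ) (hD : 0 ≤ D) (hρ : 0 ≤ ρ) (hρ' : ρ * etaC < 1)
    (h : ∀ n, j ≤ n → (cls n : ℝ) ≤
      D * (n : ℝ) ^ p * (√6 ^ (j * n) * ρ ^ n) * ((Fset (n - j)).card : ℝ)) : Good cls j := by
  obtain ⟨D', hD', h'⟩ := Tset_add j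
  refine ⟨D * D', p, ρ, hρ, hρ', fun n hn K hF => ?_⟩
  have hK : 0 ≤ K := by
    have h1 : (0 : ℝ) < (Tset (n - j)).card := by exact_mod_cast Tset_pos (n - j)
    have h2 : (0 : ℝ) ≤ K * ((Tset (n - j)).card : ℝ) := le_trans (by positivity) hF
    exact nonneg_of_mul_nonneg_left h2 h1
  calc (cls n : ℝ) ≤ _ := h n hn
    _ ≤ D * (n : ℝ) ^ p * (√6 ^ (j * n) * ρ ^ n) * (K * ((Tset (n - j)).card : ℝ)) := by gcongr
    _ = D * (n : ℝ) ^ p * ρ ^ n * K * (√6 ^ (j * n) * ((Tset (n - j)).card : ℝ)) := by ring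
    _ ≤ D * (n : ℝ) ^ p * ρ ^ n * K * (D' * ((Tset n).card : ℝ)) := by
        have := h' n hn
        gcongr
    _ = _ := by ring

lemma sqrt6_sq : (√6 : ℝ) ^ 2 = 6 := Real.sq_sqrt (by norm_num)

lemma goodA (k : ℕ) : Good (fun n => (clsA n k).card) 1 := by
  have hs : (0 : ℝ) < √6 := by positivity
  refine good_of _ 1 (k + 2) (2 * (3 / 2 : ℝ) ^ (k + 1)) (2 / √6) (by positivity) (by positivity)
    ?_ ?_
  · have h1 : (9 / 4 : ℝ) ≤ √6 := Real.le_sqrt_of_sq_le (by norm_num)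
    have h2 : 2 / √6 ≤ 8 / 9 := by
      rw [div_le_iff₀ hs]; linarith
    calc 2 / √6 * etaC ≤ 8 / 9 * etaC := by have := etaC_pos; gcongr
      _ < 1 := by have := etaC_lt; linarith
  · intro n _
    refine (cardA n k).trans (le_of_eq ?_)
    rw [one_mul, ← mul_pow, mul_div_cancel₀ _ hs.ne']

lemma pow_aux (a b : ℕ) :
    (2 : ℝ) ^ ((a + b) + (a + b)) * (3 / 2 : ℝ) ^ a = √6 ^ (2 * (a + b)) * (2 / 3 : ℝ) ^ b := by
  rw [pow_mul, sqrt6_sq, pow_add 2, ← mul_pow, pow_add, pow_add]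
  have h1 : (6 : ℝ) ^ a = (2 * 2) ^ a * (3 / 2) ^ a := by rw [← mul_pow]; norm_num
  have h2 : ((2 : ℝ) * 2) ^ b = 6 ^ b * (2 / 3) ^ b := by rw [← mul_pow]; norm_num
  rw [h1, h2]; ring

lemma goodB : Good (fun n => (clsB n 2000).card) 2000 := by
  refine good_of _ 2000 2000 ((2 : ℝ) ^ (2000 * 2000)) (8 / 9) (by positivity) (by norm_num)
    (by have := etaC_lt; linarith) ?_
  intro n _
  refine (cardB n 2000 (998 * n) (by intro r hr; omega)).trans (le_of_eq ?_)
  have e1 : 2000 * n = (998 * n + 2 * n) + (998 * n + 2 * n) := by ring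
  have e2 : 2000 * n = 2 * (998 * n + 2 * n) := by ring
  have h : (2 : ℝ) ^ (2000 * n) * (3 / 2 : ℝ) ^ (998 * n) =
      √6 ^ (2000 * n) * (2 / 3 : ℝ) ^ (2 * n) := by
    conv_lhs => rw [e1]
    conv_rhs => rw [e2]
    exact pow_aux _ _
  have h3 : (8 / 9 : ℝ) ^ n = 2 ^ n * (2 / 3 : ℝ) ^ (2 * n) := by
    rw [pow_mul, ← mul_pow]; norm_num
  rw [h, h3]
  generalize (2 : ℝ) ^ (2000 * 2000) = A
  generalize √6 ^ (2000 * n) = B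
  generalize (n : ℝ) ^ 2000 = C
  ring

lemma goodC (k : ℕ) : Good (fun n => (clsC n k).card) 2 := by
  obtain ⟨D, hD, h⟩ := cardC k
  refine good_of _ 2 (2 * k + 4) D rhoC hD.le (by unfold rhoC; positivity) rhoC_eta ?_
  intro n _
  have := h n
  rw [pow_mul, sqrt6_sq]
  exact this

lemma good_eventually {cls : ℕ → ℕ} {j : ℕ} (h : Good cls j) :
    ∃ N, ∀ n, N ≤ n → j ≤ n ∧ ∀ c : ℝ, 1 ≤ c →
      ((Fset (n - j)).card : ℝ) ≤ (1 + c) * ((Tset (n - j)).card : ℝ) →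
      (cls n : ℝ) ≤ c / 3 * (etaC ^ n)⁻¹ * ((Tset n).card : ℝ) := by
  obtain ⟨D, p, ρ, hρ, hρ', h⟩ := h
  have heta := etaC_pos
  have hlim : Filter.Tendsto (fun n : ℕ => D * ((n : ℝ) ^ p * (ρ * etaC) ^ n)) Filter.atTop
      (nhds (D * 0)) :=
    (tendsto_pow_const_mul_const_pow_of_abs_lt_one p
      (by rwa [abs_of_nonneg (by positivity)])).const_mul D
  rw [mul_zero] at hlim
  have hev := hlim.eventually_le_const (show (0 : ℝ) < 1 / 6 by norm_num)
  obtain ⟨N, hN⟩ := Filter.eventually_atTop.1 hev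
  refine ⟨max N j, fun n hn => ⟨le_trans (le_max_right _ _) hn, fun c hc hF => ?_⟩⟩
  have h1 := hN n (le_trans (le_max_left _ _) hn)
  have h2 := h n (le_trans (le_max_right _ _) hn) (1 + c) hF
  have hpow : 0 < etaC ^ n := by positivity
  have h3 : D * (n : ℝ) ^ p * ρ ^ n ≤ 1 / 6 * (etaC ^ n)⁻¹ := by
    rw [← div_eq_mul_inv, le_div_iff₀ hpow]
    refine le_trans (le_of_eq ?_) h1
    rw [mul_pow]; ring
  calc (cls n : ℝ) ≤ _ := h2
    _ ≤ 1 / 6 * (etaC ^ n)⁻¹ * ((c + c) * ((Tset n).card : ℝ)) := by gcongr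
    _ = _ := by ring

/-- There is `c ≥ 1` with `|F(n)| ≤ (1 + c·η^{-n})·|T(n)|` for all `n ≥ 1`,
where `η = 2^{1/3000}`. -/
theorem Fcard_le_one_add_eta_pow_mul_Tcard :
    ∃ c : ℝ, 1 ≤ c ∧ ∀ n : ℕ, 1 ≤ n →
      ((Fset n).card : ℝ) ≤
        (1 + c * ((2 : ℝ) ^ ((1 : ℝ) / 3000)) ^ (-(n : ℝ))) * ((Tset n).card : ℝ) := by
  obtain ⟨NA, hA⟩ := good_eventually (goodA 2000)
  obtain ⟨NB, hB⟩ := good_eventually goodB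
  obtain ⟨NC, hC⟩ := good_eventually (goodC 2000)
  have heta := etaC_pos
  obtain ⟨N, hN⟩ : ∃ N, N = NA + NB + NC := ⟨_, rfl⟩
  obtain ⟨c, hc⟩ : ∃ c : ℝ, c = 1 + ∑ i ∈ Finset.range N, ((Fset i).card : ℝ) * etaC ^ i :=
    ⟨_, rfl⟩
  have hc1 : 1 ≤ c := by
    rw [hc]
    have : 0 ≤ ∑ i ∈ Finset.range N, ((Fset i).card : ℝ) * etaC ^ i :=
      Finset.sum_nonneg (fun i _ => by positivity)
    linarith
  have main : ∀ n : ℕ, ((Fset n).card : ℝ) ≤ (1 + c * (etaC ^ n)⁻¹) * ((Tset n).card : ℝ) := by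
    intro n
    induction n using Nat.strong_induction_on with
    | _ n ih =>
      have hT : (1 : ℝ) ≤ (Tset n).card := by exact_mod_cast Tset_pos n
      have hpow : 0 < etaC ^ n := by positivity
      by_cases hn : n < N
      · have h1 : ((Fset n).card : ℝ) * etaC ^ n ≤
            ∑ i ∈ Finset.range N, ((Fset i).card : ℝ) * etaC ^ i :=
          Finset.single_le_sum (f := fun i => ((Fset i).card : ℝ) * etaC ^ i)
            (fun i _ => by positivity) (Finset.mem_range.2 hn)
        have h2 : ((Fset n).card : ℝ) ≤ c * (etaC ^ n)⁻¹ := by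
          rw [← div_eq_mul_inv, le_div_iff₀ hpow]
          linarith
        have h3 : 0 ≤ c * (etaC ^ n)⁻¹ := by positivity
        nlinarith
      · push Not at hn
        obtain ⟨a1, a2⟩ := hA n (by omega)
        obtain ⟨b1, b2⟩ := hB n (by omega)
        obtain ⟨c1, c2⟩ := hC n (by omega)
        have hF : ∀ j, 1 ≤ j → j ≤ n →
            ((Fset (n - j)).card : ℝ) ≤ (1 + c) * ((Tset (n - j)).card : ℝ) := by
          intro j hj hjn
          refine (ih (n - j) (by omega)).trans ?_
          have : (etaC ^ (n - j))⁻¹ ≤ 1 := inv_le_one_of_one_le₀ (one_le_pow₀ etaC_one_le)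
          gcongr
          nlinarith
        have ra := a2 c hc1 (hF 1 le_rfl a1)
        have rb := b2 c hc1 (hF 2000 (by norm_num) b1)
        have rc := c2 c hc1 (hF 2 (by norm_num) c1)
        have hs : ((Fset n).card : ℝ) ≤ (Tset n).card + (clsA n 2000).card + (clsB n 2000).card +
            (clsC n 2000).card := by
          have := Fset_split n 2000 a1 (by norm_num)
          exact_mod_cast this
        calc ((Fset n).card : ℝ) ≤ _ := hs
          _ ≤ (Tset n).card + c / 3 * (etaC ^ n)⁻¹ * ((Tset n).card : ℝ) +
              c / 3 * (etaC ^ n)⁻¹ * ((Tset n).card : ℝ) +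
              c / 3 * (etaC ^ n)⁻¹ * ((Tset n).card : ℝ) := by gcongr
          _ = _ := by ring
  refine ⟨c, hc1, fun n _ => ?_⟩
  have := main n
  rw [Real.rpow_neg (by positivity), Real.rpow_natCast]
  exact this
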